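/- Let λ > 0, let Z be a real random variable with density p satisfying p(z)/p_N(z; 0, 1) → 1 as z → +∞, and let X = S(Z; λ) have density q satisfying the change-of-variables identity q(S(z; λ))·S'(z; λ) = p(z) for all z ∈ ℝ. Then q(x) ∼ (1/2)·(1 + λx)^(−1−1/λ) as x → ∞; that is, q is asymptotically equivalent to one half of the generalized Pareto density with shape λ and scale 1. -/

import Mathlib

open MeasureTheory Real Filter

/-- The complementary error function `erfc(z) = (2/√π) ∫_z^∞ exp(-t²) dt`. -/
noncomputable def erfc (z : ℝ) : ℝ :=
  (2 / Real.sqrt Real.pi) * ∫ t in Set.Ioi z, Real.exp (-t ^ 2)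

/-- The simplified TTF transformation `S(z; λ) = (1/λ)(erfc(z/√2)^(-λ) - 1)`. -/
noncomputable def ttf (lam z : ℝ) : ℝ :=
  (1 / lam) * ((erfc (z / Real.sqrt 2)) ^ (-lam) - 1)

/-- Derivative of the simplified TTF transformation:
`S'(z; λ) = √(2/π) exp(-z²/2) erfc(z/√2)^(-λ-1)`. -/
noncomputable def ttfDeriv (lam z : ℝ) : ℝ :=
  Real.sqrt (2 / Real.pi) * Real.exp (-z ^ 2 / 2) * (erfc (z / Real.sqrt 2)) ^ (-lam - 1)

/-- The density of the normal distribution `N(μ, σ²)`. -/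
noncomputable def normalPDF (m σ z : ℝ) : ℝ :=
  (1 / (σ * Real.sqrt (2 * Real.pi))) * Real.exp (-(z - m) ^ 2 / (2 * σ ^ 2))

lemma aux_int : Integrable (fun t : ℝ => Real.exp (-t ^ 2)) := by
  simpa using integrable_exp_neg_mul_sq (b := 1) one_pos

lemma erfc_eq (z : ℝ) : erfc z = (2 / Real.sqrt Real.pi) *
    ((∫ t in Set.Ioi (0:ℝ), Real.exp (-t ^ 2)) - ∫ t in (0:ℝ)..z, Real.exp (-t ^ 2)) := by
  unfold erfc
  rw [← intervalIntegral.integral_Ioi_sub_Ioi' aux_int.integrableOn aux_int.integrableOn]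
  ring

lemma erfc_cont : Continuous erfc := by
  rw [show erfc = _ from funext erfc_eq]
  have := intervalIntegral.continuous_primitive
    (fun a b => aux_int.intervalIntegrable (a := a) (b := b)) 0
  fun_prop

lemma erfc_lim : Tendsto erfc atTop (nhds 0) := by
  rw [show erfc = _ from funext erfc_eq]
  have : Tendsto (fun z : ℝ => ∫ t in (0:ℝ)..z, Real.exp (-t ^ 2)) atTop
      (nhds (∫ t in Set.Ioi (0:ℝ), Real.exp (-t ^ 2))) :=
    intervalIntegral_tendsto_integral_Ioi 0 aux_int.integrableOn tendsto_id
  have h2 := (this.const_sub (∫ t in Set.Ioi (0:ℝ), Real.exp (-t ^ 2))).const_mul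
    (2 / Real.sqrt Real.pi)
  rw [sub_self, mul_zero] at h2
  exact h2

lemma erfc_pos (z : ℝ) : 0 < erfc z := by
  unfold erfc
  have : 0 < ∫ t in Set.Ioi z, Real.exp (-t ^ 2) := by
    rw [setIntegral_pos_iff_support_of_nonneg_ae
      (Eventually.of_forall fun t => (Real.exp_pos _).le) aux_int.integrableOn]
    have : Function.support (fun t : ℝ => Real.exp (-t ^ 2)) = Set.univ := by
      ext t; simp [Real.exp_ne_zero]
    rw [this]; simp
  positivity

lemma erfc_anti : Antitone erfc := by
  intro a b hab
  unfold erfc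
  apply mul_le_mul_of_nonneg_left _ (by positivity)
  exact setIntegral_mono_set aux_int.integrableOn
    (Eventually.of_forall fun t => (Real.exp_pos _).le)
    (Set.Ioi_subset_Ioi hab).eventuallyLE

/-- if `p(z) ∼ p_N(z; 0, 1)` as `z → ∞` and `X = S(Z; λ)` has density `q`
related to `p` by the change-of-variables identity, then
`q(x) ∼ (1/2)(1 + λx)^(-1-1/λ)` as `x → ∞`, i.e. `q` is asymptotically equivalent to
one half of the generalized Pareto density with shape `λ` and scale `1`. -/
theorem ttf_gpd_tail
    {Ω : Type*} [MeasurableSpace Ω] (P : Measure Ω) [IsProbabilityMeasure P]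
    (lam : ℝ) (hlam : 0 < lam)
    (Z : Ω → ℝ) (hZ : Measurable Z) (p q : ℝ → ℝ)
    (hp : Measure.map Z P = volume.withDensity (fun z => ENNReal.ofReal (p z)))
    (hptail : Tendsto (fun z => p z / normalPDF 0 1 z) atTop (nhds 1))
    (hq : ∀ z : ℝ, q (ttf lam z) * ttfDeriv lam z = p z) :
    Tendsto (fun x => q x / ((1 / 2) * (1 + lam * x) ^ (-1 - 1 / lam)))
      atTop (nhds 1) := by
  have hs2 : (0:ℝ) < Real.sqrt 2 := by positivity
  set E : ℝ → ℝ := fun z => erfc (z / Real.sqrt 2) with hE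
  have hEpos : ∀ z, 0 < E z := fun z => erfc_pos _
  have hEcont : Continuous E := erfc_cont.comp (by fun_prop)
  have hElim : Tendsto E atTop (nhds 0) := erfc_lim.comp (tendsto_id.atTop_div_const hs2)
  have hEanti : Antitone E := fun a b hab => erfc_anti (by gcongr)
  have hbase : Tendsto (fun x : ℝ => 1 + lam * x) atTop atTop :=
    tendsto_atTop_add_const_left _ _ (tendsto_id.const_mul_atTop hlam)
  have hylim : Tendsto (fun x : ℝ => (1 + lam * x) ^ (-(1 / lam))) atTop (nhds 0) :=
    (tendsto_rpow_neg_atTop (by positivity)).comp hbase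
  have hex : ∀ y, 0 < y → y < E 0 → ∃ z, E z = y := by
    intro y hy hy0
    obtain ⟨b, hb⟩ := (hElim.eventually (gt_mem_nhds hy)).exists
    exact mem_range_of_exists_le_of_exists_ge hEcont ⟨b, hb.le⟩ ⟨0, hy0.le⟩
  have hev : ∀ᶠ x : ℝ in atTop, ∃ z, E z = (1 + lam * x) ^ (-(1 / lam)) := by
    filter_upwards [hylim.eventually (gt_mem_nhds (hEpos 0)), hbase.eventually_gt_atTop 0]
      with x h1 h2
    exact hex _ (Real.rpow_pos_of_pos h2 _) h1
  let g : ℝ → ℝ := fun x => Classical.epsilon (fun z => E z = (1 + lam * x) ^ (-(1 / lam)))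
  have hg : ∀ᶠ x : ℝ in atTop, E (g x) = (1 + lam * x) ^ (-(1 / lam)) := by
    filter_upwards [hev] with x hx
    exact Classical.epsilon_spec hx
  have hglim : Tendsto g atTop atTop := by
    rw [tendsto_atTop]
    intro M
    filter_upwards [hg, hylim.eventually (gt_mem_nhds (hEpos M))] with x h1 h2
    by_contra hc
    have := hEanti (not_le.mp hc).le
    linarith
  refine (hptail.comp hglim).congr' ?_
  filter_upwards [hg, hbase.eventually_gt_atTop 0] with x hx hpos
  have hl : lam ≠ 0 := hlam.ne'
  have e1 : (E (g x)) ^ (-lam) = 1 + lam * x := by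
    rw [hx, ← Real.rpow_mul hpos.le]
    have : -(1 / lam) * -lam = 1 := by field_simp
    rw [this, Real.rpow_one]
  have e2 : ttf lam (g x) = x := by
    change (1 / lam) * ((E (g x)) ^ (-lam) - 1) = x
    rw [e1]; field_simp; ring
  have e3 : (1 + lam * x) ^ (-1 - 1 / lam) = (E (g x)) ^ (lam + 1) := by
    rw [hx, ← Real.rpow_mul hpos.le]
    congr 1; field_simp; ring
  have e4 : (E (g x)) ^ (-lam - 1) = ((E (g x)) ^ (lam + 1))⁻¹ := by
    rw [← Real.rpow_neg (hEpos _).le]; congr 1; ring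
  have hq' := hq (g x)
  rw [e2] at hq'
  have hA : 0 < (E (g x)) ^ (lam + 1) := Real.rpow_pos_of_pos (hEpos _) _
  have hD : ttfDeriv lam (g x) =
      Real.sqrt (2 / Real.pi) * Real.exp (-(g x) ^ 2 / 2) * ((E (g x)) ^ (lam + 1))⁻¹ := by
    rw [← e4]; rfl
  have hc : 1 / Real.sqrt (2 * Real.pi) = Real.sqrt (2 / Real.pi) / 2 := by
    have h2 : Real.sqrt 2 * Real.sqrt 2 = 2 := Real.mul_self_sqrt (by norm_num)
    have hpi : 0 < Real.sqrt Real.pi := Real.sqrt_pos.2 Real.pi_pos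
    rw [Real.sqrt_mul (by norm_num), Real.sqrt_div (by norm_num)]
    field_simp
    nlinarith
  have hN : normalPDF 0 1 (g x) =
      Real.sqrt (2 / Real.pi) / 2 * Real.exp (-(g x) ^ 2 / 2) := by
    unfold normalPDF
    rw [← hc]; simp
  have hspos : 0 < Real.sqrt (2 / Real.pi) := Real.sqrt_pos.2 (by positivity)
  have hexp := Real.exp_pos (-(g x) ^ 2 / 2)
  simp only [Function.comp]
  rw [e3, hN, ← hq', hD]
  generalize (E (g x)) ^ (lam + 1) = A at *
  generalize Real.exp (-(g x) ^ 2 / 2) = B at *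
  generalize Real.sqrt (2 / Real.pi) = C at *
  field_simp
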